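/- Let q ≥ 4 be a prime power, let C be any [q^2+1, 4, q^2−q] code over GF(q), and let t_1 be any coordinate position. Then: (1) in the shortened code C_{{t_1}} (a [q^2, 3, q^2−q] code), for every pair of distinct coordinate positions {i, j} of C_{{t_1}}, the number of codewords of C_{{t_1}} of Hamming weight q^2−q whose support contains both i and j is exactly (q−1)(q^2−q−1); and (2) in the code D = ((C^⊥)_{{t_1}})^⊥ (a [q^2, 4, q^2−q−1] code), for every pair of distinct coordinate positions {i, j} of D, the number of codewords of D of Hamming weight q^2−q whose support contains both i and j is exactly (q−1)(q^2−q−1), and the number of codewords of D of Hamming weight q^2−q whose support contains neither i nor j is exactly q−1 (so the complements of the supports of the weight-(q^2−q) codewords of D, each occurring with multiplicity q−1, form a Steiner system 2-(q^2, q, 1), i.e., an affine plane of order q). -/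

import Mathlib

open Finset

section Defs

variable {F : Type} [Field F]

/-- The dual of a linear code `C ⊆ F^ι` w.r.t. the standard inner product. -/
def dualCode {ι : Type} [Fintype ι] (C : Submodule F (ι → F)) :
    Submodule F (ι → F) where
  carrier := {x | ∀ c ∈ C, ∑ i, x i * c i = 0}
  add_mem' := by
    intro a b ha hb c hc
    simp only [Set.mem_setOf_eq] at ha hb ⊢
    simp only [Pi.add_apply, add_mul, Finset.sum_add_distrib, ha c hc, hb c hc, add_zero]
  zero_mem' := by
    intro c hc
    simp
  smul_mem' := by
    intro r a ha c hc
    simp only [Set.mem_setOf_eq] at ha ⊢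
    simp only [Pi.smul_apply, smul_eq_mul, mul_assoc, ← Finset.mul_sum, ha c hc, mul_zero]

/-- The subcode of codewords vanishing on every coordinate in `T`. -/
def zeroOn {ι : Type} (T : Finset ι) : Submodule F (ι → F) where
  carrier := {x | ∀ i ∈ T, x i = 0}
  add_mem' := by
    intro a b ha hb i hi
    simp only [Set.mem_setOf_eq] at ha hb
    simp [Pi.add_apply, ha i hi, hb i hi]
  zero_mem' := by intro i _; simp
  smul_mem' := by
    intro r a ha i hi
    simp only [Set.mem_setOf_eq] at ha
    simp [Pi.smul_apply, ha i hi]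

/-- Deleting the coordinates in `T`. -/
def restrictTo {ι : Type} (T : Finset ι) : (ι → F) →ₗ[F] ({i : ι // i ∉ T} → F) :=
  LinearMap.funLeft F F Subtype.val

/-- The punctured code `C^T`: delete the coordinates in `T` from every codeword. -/
def puncturedCode {ι : Type} (C : Submodule F (ι → F)) (T : Finset ι) :
    Submodule F ({i : ι // i ∉ T} → F) :=
  C.map (restrictTo T)

/-- The shortened code `C_T`: take the codewords vanishing on `T`, then delete `T`. -/
def shortenedCode {ι : Type} (C : Submodule F (ι → F)) (T : Finset ι) :
    Submodule F ({i : ι // i ∉ T} → F) :=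
  (C ⊓ zeroOn T).map (restrictTo T)

/-- The code `C` has minimum distance (exactly) `d`. -/
def IsMinDist {ι : Type} [Fintype ι] [DecidableEq F] (C : Submodule F (ι → F)) (d : ℕ) : Prop :=
  (∃ c ∈ C, c ≠ 0 ∧ hammingNorm c = d) ∧ ∀ c ∈ C, c ≠ 0 → d ≤ hammingNorm c

/-- `A_k(C)`: the number of codewords of Hamming weight `k` in `C`. -/
noncomputable def weightCount {ι : Type} [Fintype ι] [DecidableEq F]
    (C : Submodule F (ι → F)) (k : ℕ) : ℕ :=
  Nat.card {c : ι → F // c ∈ C ∧ hammingNorm c = k}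

/-- A monomial transformation: permute the coordinates and scale each coordinate. -/
def monomialMap {ι κ : Type} (σ : ι ≃ κ) (u : κ → F) : (ι → F) →ₗ[F] (κ → F) where
  toFun x := fun j => u j * x (σ.symm j)
  map_add' a b := by
    funext j
    simp [Pi.add_apply, mul_add]
  map_smul' r a := by
    funext j
    simp only [Pi.smul_apply, smul_eq_mul, RingHom.id_apply]
    ring

/-- Monomial equivalence of linear codes. -/
def MonomiallyEquiv {ι κ : Type} (C : Submodule F (ι → F)) (D : Submodule F (κ → F)) : Prop :=
  ∃ (σ : ι ≃ κ) (u : κ → F), (∀ j, u j ≠ 0) ∧ D = C.map (monomialMap σ u)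

/-- The syndrome map attached to a parity-check matrix with columns `v i`. -/
def checkMap {m n : ℕ} (v : Fin n → (Fin m → F)) : (Fin n → F) →ₗ[F] (Fin m → F) where
  toFun x := fun j => ∑ i, x i * v i j
  map_add' a b := by
    funext j
    simp [Pi.add_apply, add_mul, Finset.sum_add_distrib]
  map_smul' r a := by
    funext j
    simp [Pi.smul_apply, Finset.mul_sum, mul_assoc]

/-- `v` lists exactly one nonzero vector from each one-dimensional subspace of `F^m`. -/
def IsHammingMatrix {m n : ℕ} (v : Fin n → (Fin m → F)) : Prop :=
  (∀ i, v i ≠ 0) ∧ ∀ w : Fin m → F, w ≠ 0 → ∃! i : Fin n, ∃ c : F, w = c • v i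

/-- The Hamming code attached to a parity-check matrix whose columns are the `v i`. -/
def hammingCode {m n : ℕ} (v : Fin n → (Fin m → F)) : Submodule F (Fin n → F) :=
  LinearMap.ker (checkMap v)

/-- The Simplex code: the dual of the Hamming code. -/
def simplexCode {m n : ℕ} (v : Fin n → (Fin m → F)) : Submodule F (Fin n → F) :=
  dualCode (hammingCode v)

end Defs

section Helpers

lemma mem_zeroOn' {F : Type} [Field F] {ι : Type} (T : Finset ι) (x : ι → F) :
    x ∈ (zeroOn T : Submodule F (ι → F)) ↔ ∀ i ∈ T, x i = 0 := Iff.rfl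

/-- adding one vanishing condition drops the dimension by at most one -/
lemma finrank_drop {F : Type} [Field F] [Fintype F] [DecidableEq F] {ι : Type} [Fintype ι]
    (W : Submodule F (ι → F)) (l : ι) :
    Module.finrank F W ≤
      Module.finrank F (W ⊓ zeroOn {l} : Submodule F (ι → F)) + 1 := by
  let f : W →ₗ[F] F := (LinearMap.proj l).comp W.subtype
  have h1 := LinearMap.finrank_range_add_finrank_ker f
  have h2 : Module.finrank F (LinearMap.range f) ≤ 1 := by
    have := Submodule.finrank_le (LinearMap.range f)
    simpa using this
  have h3 : (LinearMap.ker f).map W.subtype = W ⊓ zeroOn {l} := by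
    ext x
    simp [f, mem_zeroOn']
    tauto
  have h4 := LinearEquiv.finrank_eq
    (Submodule.equivMapOfInjective W.subtype W.injective_subtype (LinearMap.ker f))
  rw [h3] at h4
  omega

open Classical in
lemma card_sub {F : Type} [Field F] [Fintype F] [DecidableEq F] {ι : Type} [Fintype ι]
    (W : Submodule F (ι → F)) :
    #{c : ι → F | c ∈ W ∧ c ≠ 0} + 1 = Fintype.card F ^ Module.finrank F W := by
  have h := Module.natCard_eq_pow_finrank (K := F) (V := W)
  rw [Nat.card_eq_fintype_card] at h
  rw [← Nat.card_eq_fintype_card (α := F), ← h]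
  have : Fintype.card W = #{c : ι → F | c ∈ W} := by
    exact Fintype.card_subtype (fun c => c ∈ W)
  rw [this]
  have e : ({c : ι → F | c ∈ W ∧ c ≠ 0} : Finset (ι → F)) =
      ({c : ι → F | c ∈ W} : Finset (ι → F)).erase 0 := by
    ext; simp [and_comm]
  rw [e]
  exact Finset.card_erase_add_one (by simp)

open Classical in
lemma two_dim {F : Type} [Field F] [Fintype F] [DecidableEq F] {ι : Type} [Fintype ι]
    (hcard : Fintype.card ι = Fintype.card F ^ 2 + 1)
    (W : Submodule F (ι → F)) (hW : Module.finrank F W = 2)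
    (hZ : ∀ c ∈ W, c ≠ 0 → #{l | c l = 0} ≤ Fintype.card F + 1)
    (T : Finset ι) (hT : ∀ c ∈ W, ∀ l ∈ T, c l = 0) :
    #T ≤ 2 ∧ (#T = 2 → ∀ c ∈ W, c ≠ 0 → #{l | c l = 0} = Fintype.card F + 1) := by
  set q := Fintype.card F with hq
  have hq2 : 2 ≤ q := Fintype.one_lt_card
  obtain ⟨p, hp⟩ : ∃ p, q = p + 1 := ⟨q - 1, by omega⟩
  have hS := card_sub W
  rw [hW, ← hq] at hS
  set S : Finset (ι → F) := {c : ι → F | c ∈ W ∧ c ≠ 0} with hSd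
  have hdc : ∑ c ∈ S, #{l | c l = 0} = ∑ l : ι, #{c ∈ S | c l = 0} := by
    simp only [Finset.card_filter]
    exact Finset.sum_comm
  have hlow : ∀ l, q - 1 ≤ #{c ∈ S | c l = 0} := by
    intro l
    have h1 := finrank_drop W l
    have h2 := card_sub (W ⊓ zeroOn {l})
    rw [← hq] at h2
    have h3 : q ^ 1 ≤ q ^ Module.finrank F (W ⊓ zeroOn {l} : Submodule F (ι → F)) :=
      Nat.pow_le_pow_right (by omega) (by omega)
    have h4 : ({c : ι → F | c ∈ W ⊓ zeroOn {l} ∧ c ≠ 0} : Finset (ι → F)) =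
       {c ∈ S | c l = 0} := by
      ext c; simp [hSd, mem_zeroOn']; tauto
    rw [h4] at h2
    rw [pow_one] at h3
    omega
  have hTl : ∀ l ∈ T, #{c ∈ S | c l = 0} = #S := by
    intro l hl
    congr 1
    apply Finset.filter_true_of_mem
    intro c hc
    exact hT c (by simp [hSd] at hc; exact hc.1) l hl
  have hsum : #T * #S + (q ^ 2 + 1 - #T) * (q - 1) ≤ ∑ c ∈ S, #{l | c l = 0} := by
    rw [hdc, ← Finset.sum_add_sum_compl T, Finset.sum_congr rfl hTl, Finset.sum_const, smul_eq_mul]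
    have : #(Tᶜ) * (q - 1) ≤ ∑ l ∈ Tᶜ, #{c ∈ S | c l = 0} := by
      rw [← smul_eq_mul]
      exact Finset.card_nsmul_le_sum _ _ _ (fun l _ => hlow l)
    rw [Finset.card_compl, hcard] at this
    omega
  have hZ' : ∀ c ∈ S, #{l | c l = 0} ≤ q + 1 := by
    intro c hc
    simp [hSd] at hc
    exact hZ c hc.1 hc.2
  have hup : ∑ c ∈ S, #{l | c l = 0} ≤ #S * (q + 1) := by
    rw [← smul_eq_mul]
    exact Finset.sum_le_card_nsmul _ _ _ hZ'
  have hTn : #T ≤ q ^ 2 + 1 := by rw [← hcard]; exact Finset.card_le_univ T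
  obtain ⟨m, hm⟩ := Nat.exists_eq_add_of_le hTn
  have hSv : #S = p * (p + 2) := by
    have : #S + 1 = p * (p + 2) + 1 := by rw [hS, hp]; ring
    omega
  have hm' : q ^ 2 + 1 - #T = m := by omega
  have hp' : q - 1 = p := by omega
  rw [hm', hp'] at hsum
  have hp1 : 1 ≤ p := by omega
  constructor
  · have h := hsum.trans hup
    rw [hSv] at h
    have h5 : p * (#T * (p + 2) + m) ≤ p * ((p + 2) * (q + 1)) := by
      calc _ = #T * (p * (p + 2)) + m * p := by ring
        _ ≤ _ := h
        _ = _ := by ring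
    have h6 := Nat.le_of_mul_le_mul_left h5 (by omega)
    rw [hp] at h6 hm
    by_contra hcon
    push Not at hcon
    have : 3 * (p + 1) ≤ #T * (p + 1) := Nat.mul_le_mul_right _ hcon
    nlinarith
  · intro hT2 c hc hc0
    have heq : ∑ c ∈ S, #{l | c l = 0} = ∑ c ∈ S, (q + 1) := by
      apply le_antisymm
      · exact Finset.sum_le_sum hZ'
      · refine le_trans (le_of_eq ?_) hsum
        rw [Finset.sum_const, smul_eq_mul, hSv, hT2]
        have : m = p * (p + 2) := by rw [hT2, hp] at hm; nlinarith
        rw [this, hp]; ring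
    exact (Finset.sum_eq_sum_iff_of_le hZ').1 heq c (by simp [hSd, hc, hc0])

lemma inf_zeroOn {F : Type} [Field F] {ι : Type} [DecidableEq ι]
    (C : Submodule F (ι → F)) (T : Finset ι) (l : ι) :
    (C ⊓ zeroOn T) ⊓ zeroOn {l} = C ⊓ zeroOn (insert l T) := by
  ext x
  simp [mem_zeroOn']
  tauto

open Classical in
lemma dims {F : Type} [Field F] [Fintype F] [DecidableEq F] {ι : Type} [Fintype ι]
    (hcard : Fintype.card ι = Fintype.card F ^ 2 + 1)
    (C : Submodule F (ι → F)) (hdim : Module.finrank F C = 4)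
    (hZ : ∀ c ∈ C, c ≠ 0 → #{l | c l = 0} ≤ Fintype.card F + 1)
    (T : Finset ι) (hT : #T ≤ 3) :
    Module.finrank F (C ⊓ zeroOn T : Submodule F (ι → F)) = 4 - #T := by
  have hq2 : 2 ≤ Fintype.card F := Fintype.one_lt_card
  have low : ∀ T : Finset ι, 4 ≤ Module.finrank F (C ⊓ zeroOn T : Submodule F (ι → F)) + #T := by
    intro T
    induction T using Finset.induction_on with
    | empty =>
      have : C ⊓ zeroOn (∅ : Finset ι) = C := by
        ext; simp [mem_zeroOn']
      rw [this, hdim]; simp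
    | insert l T hl ih =>
      have := finrank_drop (C ⊓ zeroOn T) l
      rw [inf_zeroOn] at this
      rw [Finset.card_insert_of_notMem hl]
      omega
  have up3 : ∀ T : Finset ι, #T = 3 →
      Module.finrank F (C ⊓ zeroOn T : Submodule F (ι → F)) ≤ 1 := by
    intro T hT
    by_contra hcon
    push Not at hcon
    obtain ⟨W, hWle, hWr⟩ : ∃ W ≤ C ⊓ zeroOn T, Module.finrank F W = 2 := by
      obtain ⟨f, hf⟩ := (finrank_le_iff_exists_linearMap (R := F) (M := Fin 2 → F)
        (M' := (C ⊓ zeroOn T : Submodule F (ι → F)))).1 (by rw [Module.finrank_fin_fun]; exact hcon)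
      refine ⟨LinearMap.range ((C ⊓ zeroOn T).subtype.comp f), ?_, ?_⟩
      · rintro _ ⟨y, rfl⟩
        exact (f y).2
      · rw [LinearMap.finrank_range_of_inj]
        · simp
        · exact (Submodule.injective_subtype _).comp hf
    have := (two_dim hcard W hWr (fun c hc => hZ c (hWle hc).1) T
      (fun c hc => (hWle hc).2)).1
    omega
  have up : ∀ k, ∀ T : Finset ι, #T + k = 3 →
      Module.finrank F (C ⊓ zeroOn T : Submodule F (ι → F)) ≤ 1 + k := by
    intro k
    induction k with
    | zero => intro T hT; exact up3 T hT
    | succ k ih =>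
      intro T hT
      obtain ⟨l, hl⟩ : ∃ l, l ∉ T := by
        by_contra hcon
        push Not at hcon
        have : T = univ := by ext; simp [hcon]
        rw [this, Finset.card_univ, hcard] at hT
        nlinarith
      have h1 := finrank_drop (C ⊓ zeroOn T) l
      rw [inf_zeroOn] at h1
      have h2 := ih (insert l T) (by rw [Finset.card_insert_of_notMem hl]; omega)
      omega
  have h1 := low T
  have h2 := up (3 - #T) T (by omega)
  omega

open Classical in
lemma core_Z {F : Type} [Field F] [Fintype F] [DecidableEq F] {ι : Type} [Fintype ι]
    (hcard : Fintype.card ι = Fintype.card F ^ 2 + 1)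
    (C : Submodule F (ι → F)) (hdim : Module.finrank F C = 4)
    (hZ : ∀ c ∈ C, c ≠ 0 → #{l | c l = 0} ≤ Fintype.card F + 1)
    (c : ι → F) (hc : c ∈ C) (hc0 : c ≠ 0) (i j : ι) (hij : i ≠ j) (hi : c i = 0) (hj : c j = 0) :
    #{l | c l = 0} = Fintype.card F + 1 := by
  have h2 : #({i, j} : Finset ι) = 2 := Finset.card_pair hij
  have hd := dims hcard C hdim hZ {i, j} (by omega)
  rw [h2] at hd
  exact (two_dim hcard (C ⊓ zeroOn {i, j}) hd (fun c hc => hZ c hc.1) {i, j}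
    (fun c hc => hc.2)).2 h2 c ⟨hc, by simp [mem_zeroOn', hi, hj]⟩ hc0

open Classical in
lemma core_count {F : Type} [Field F] [Fintype F] [DecidableEq F] {ι : Type} [Fintype ι]
    (hcard : Fintype.card ι = Fintype.card F ^ 2 + 1)
    (C : Submodule F (ι → F)) (hdim : Module.finrank F C = 4)
    (hZ : ∀ c ∈ C, c ≠ 0 → #{l | c l = 0} ≤ Fintype.card F + 1)
    (t i j : ι) (hti : t ≠ i) (htj : t ≠ j) (hij : i ≠ j) :
    #{c : ι → F | c ∈ C ∧ c ≠ 0 ∧ c t = 0 ∧ #{l | c l = 0} = Fintype.card F + 1 ∧ c i ≠ 0 ∧ c j ≠ 0}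
      = (Fintype.card F - 1) * (Fintype.card F ^ 2 - Fintype.card F - 1) ∧
    #{c : ι → F | c ∈ C ∧ c ≠ 0 ∧ c t = 0 ∧ #{l | c l = 0} = Fintype.card F + 1 ∧ c i = 0 ∧ c j = 0}
      = Fintype.card F - 1 := by
  have hZ2 := core_Z hcard C hdim hZ
  have hD : ∀ T : Finset ι, #T ≤ 3 →
      #{c : ι → F | c ∈ C ⊓ zeroOn T ∧ c ≠ 0} + 1 = Fintype.card F ^ (4 - #T) := by
    intro T hT
    rw [← dims hcard C hdim hZ T hT]
    exact card_sub _
  set q := Fintype.card F with hq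
  have hq2 : 2 ≤ q := Fintype.one_lt_card
  set A : Finset (ι → F) := {c : ι → F | c ∈ C ⊓ zeroOn {t} ∧ c ≠ 0} with hA
  have hAm : ∀ c, c ∈ A ↔ c ∈ C ∧ c t = 0 ∧ c ≠ 0 := by
    intro c; simp [hA, mem_zeroOn', and_assoc]
  set B : Finset (ι → F) := {c ∈ A | #{l | c l = 0} = q + 1} with hB
  have hpair : ∀ l, l ≠ t → #{c ∈ A | c l = 0} + 1 = q ^ 2 := by
    intro l hl
    have h2 : #({t, l} : Finset ι) = 2 := Finset.card_pair hl.symm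
    have := hD {t, l} (by omega)
    rw [h2] at this
    rw [← this]
    congr 2
    ext c; simp [hAm, mem_zeroOn']; tauto
  have hBA : ∀ l, l ≠ t → ({c ∈ B | c l = 0} : Finset (ι → F)) = {c ∈ A | c l = 0} := by
    intro l hl
    ext c
    simp only [hB, Finset.mem_filter, hAm]
    constructor
    · rintro ⟨⟨h1, _⟩, h2⟩; exact ⟨h1, h2⟩
    · rintro ⟨h1, h2⟩
      exact ⟨⟨h1, hZ2 c h1.1 h1.2.2 t l hl.symm h1.2.1 h2⟩, h2⟩
  have hdc : ∑ c ∈ B, #{l ∈ univ.erase t | c l = 0} = ∑ l ∈ univ.erase t, #{c ∈ B | c l = 0} := by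
    simp only [Finset.card_filter]
    exact Finset.sum_comm
  have hBcard : #B * q = q ^ 2 * (q ^ 2 - 1) := by
    have h1 : ∑ c ∈ B, #{l ∈ univ.erase t | c l = 0} = #B * q := by
      rw [Finset.sum_const_nat]
      intro c hc
      simp only [hB, Finset.mem_filter, hAm] at hc
      have : ({l ∈ univ.erase t | c l = 0} : Finset ι) = ({l | c l = 0} : Finset ι).erase t := by
        ext; simp
      rw [this, Finset.card_erase_of_mem (by simp [hc.1.2.1]), hc.2]
      rfl
    have h2 : ∑ l ∈ univ.erase t, #{c ∈ B | c l = 0} = q ^ 2 * (q ^ 2 - 1) := by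
      rw [Finset.sum_const_nat (m := q ^ 2 - 1)]
      · rw [Finset.card_erase_of_mem (by simp), Finset.card_univ, hcard]; rfl
      · intro l hl
        have hl' := Finset.ne_of_mem_erase hl
        rw [hBA l hl']
        have := hpair l hl'
        omega
    rw [← h1, hdc, h2]
  have hBi : #{c ∈ B | c i = 0} + 1 = q ^ 2 := by rw [hBA i hti.symm]; exact hpair i hti.symm
  have hBj : #{c ∈ B | c j = 0} + 1 = q ^ 2 := by rw [hBA j htj.symm]; exact hpair j htj.symm
  have hBij : #{c ∈ B | c i = 0 ∧ c j = 0} + 1 = q := by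
    have h3 : #({t, i, j} : Finset ι) = 3 := by
      rw [Finset.card_eq_three]; exact ⟨t, i, j, hti, htj, hij, rfl⟩
    have := hD {t, i, j} (by omega)
    rw [h3] at this
    have h4 : ({c ∈ B | c i = 0 ∧ c j = 0} : Finset (ι → F)) =
        ({c : ι → F | c ∈ C ⊓ zeroOn {t, i, j} ∧ c ≠ 0} : Finset (ι → F)) := by
      rw [← Finset.filter_filter, hBA i hti.symm]
      ext c; simp [hAm, mem_zeroOn']; tauto
    rw [h4, this]; simp
  have e1 : ({c : ι → F | c ∈ C ∧ c ≠ 0 ∧ c t = 0 ∧ #{l | c l = 0} = q + 1 ∧ c i ≠ 0 ∧ c j ≠ 0}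
      : Finset (ι → F)) = {c ∈ B | c i ≠ 0 ∧ c j ≠ 0} := by
    ext c; simp only [hB, Finset.mem_filter, hAm, Finset.mem_univ, true_and]; tauto
  have e2 : ({c : ι → F | c ∈ C ∧ c ≠ 0 ∧ c t = 0 ∧ #{l | c l = 0} = q + 1 ∧ c i = 0 ∧ c j = 0}
      : Finset (ι → F)) = {c ∈ B | c i = 0 ∧ c j = 0} := by
    ext c; simp only [hB, Finset.mem_filter, hAm, Finset.mem_univ, true_and]; tauto
  rw [e1, e2]
  refine ⟨?_, by omega⟩
  have s1 := Finset.card_filter_add_card_filter_not (s := B) (fun c => c i = 0)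
  have s2 := Finset.card_filter_add_card_filter_not (s := B) (fun c => c j = 0)
  have s3 := Finset.card_filter_add_card_filter_not (s := B.filter (fun c => c i ≠ 0))
    (fun c => c j = 0)
  have s4 := Finset.card_filter_add_card_filter_not (s := B.filter (fun c => c j = 0))
    (fun c => c i = 0)
  simp only [Finset.filter_filter] at s3 s4
  have e3 : ({c ∈ B | c j = 0 ∧ c i = 0} : Finset (ι → F)) = {c ∈ B | c i = 0 ∧ c j = 0} := by
    simp only [and_comm]
  have e4 : ({c ∈ B | c j = 0 ∧ ¬ c i = 0} : Finset (ι → F)) = {c ∈ B | c i ≠ 0 ∧ c j = 0} := by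
    simp only [and_comm, ne_eq]
  rw [e3, e4] at s4
  simp only [ne_eq] at *
  obtain ⟨p, hp⟩ : ∃ p, q = p + 1 := ⟨q - 1, by omega⟩
  have hBv : #B = q * (q ^ 2 - 1) := by
    apply Nat.eq_of_mul_eq_mul_right (show 0 < q by omega)
    rw [hBcard]; ring
  have g1 : q ^ 2 - 1 = p * p + 2 * p := by
    have : q ^ 2 = p * p + 2 * p + 1 := by rw [hp]; ring
    omega
  have g2 : q ^ 2 - q - 1 + 1 = p * p + p := by
    have : q ^ 2 = p * p + 2 * p + 1 := by rw [hp]; ring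
    have : 1 ≤ p * p := Nat.mul_pos (by omega) (by omega)
    omega
  have g3 : q ^ 2 = p * p + 2 * p + 1 := by rw [hp]; ring
  have g4 : q - 1 = p := by omega
  rw [g1] at hBv
  rw [g4]
  rw [g3] at hBi hBj
  generalize q ^ 2 - q - 1 = X at *
  have g5 : p * X + p = p * (p * p + p) := by rw [← g2]; ring
  have g6 : #B = p * (p * p + p) + 2 * (p * p) + 2 * p := by rw [hBv, hp]; ring
  omega

lemma dual_dual {F : Type} [Field F] {ι : Type} [Fintype ι] [DecidableEq ι]
    (C : Submodule F (ι → F)) : dualCode (dualCode C) = C := by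
  apply le_antisymm
  · intro x hx
    by_contra hxC
    obtain ⟨f, hfx, hfC⟩ := Submodule.exists_le_ker_of_notMem hxC
    have hf : ∀ y, f y = ∑ l, f (Pi.single l 1) * y l := by
      intro y
      conv_lhs => rw [pi_eq_sum_univ' y]
      simp [map_sum, mul_comm]
    apply hfx
    rw [hf]
    have : (fun l => f (Pi.single l 1)) ∈ dualCode C := by
      intro c hc
      have := hfC hc
      rw [LinearMap.mem_ker, hf] at this
      exact this
    have h := hx _ this
    rw [← h]
    exact Finset.sum_congr rfl (fun _ _ => mul_comm _ _)
  · intro c hc y hy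
    have h := hy c hc
    rw [← h]
    exact Finset.sum_congr rfl (fun _ _ => mul_comm _ _)

lemma sum_split {F : Type} [Field F] {ι : Type} [Fintype ι] [DecidableEq ι] (t : ι) (f : ι → F) :
    ∑ l, f l = f t + ∑ l : {x : ι // x ∉ ({t} : Finset ι)}, f l := by
  rw [← Finset.add_sum_erase univ f (Finset.mem_univ t)]
  congr 1
  exact Finset.sum_subtype _ (by simp) f

lemma D_eq {F : Type} [Field F] {ι : Type} [Fintype ι] [DecidableEq ι]
    (C : Submodule F (ι → F)) (t : ι) :
    dualCode (shortenedCode (dualCode C) {t}) = puncturedCode C {t} := by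
  rw [← dual_dual (puncturedCode C {t})]
  congr 1
  ext x
  constructor
  · rintro ⟨y, ⟨hy, hyt⟩, rfl⟩ _ ⟨c, hc, rfl⟩
    have h := hy c hc
    rw [sum_split t, hyt t (by simp), zero_mul, zero_add] at h
    exact h
  · intro hx
    refine ⟨fun l => if h : l ∉ ({t} : Finset ι) then x ⟨l, h⟩ else 0, ⟨?_, ?_⟩, ?_⟩
    · intro c hc
      rw [sum_split t]
      have h := hx _ ⟨c, hc, rfl⟩
      refine Eq.trans ?_ h
      simp only [Finset.mem_singleton, not_true, dif_neg, not_false_iff, zero_mul, zero_add]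
      apply Finset.sum_congr rfl
      rintro ⟨l, hl⟩ _
      have : ¬ l = t := by simpa using hl
      simp [this, restrictTo, LinearMap.funLeft]
    · intro l hl
      simp at hl
      simp [hl]
    · ext ⟨l, hl⟩
      have : ¬ l = t := by simpa using hl
      simp [this, restrictTo, LinearMap.funLeft]

lemma norm_add_zeros {F : Type} [Field F] [DecidableEq F] {ι : Type} [Fintype ι] (c : ι → F) :
    hammingNorm c + #{l | c l = 0} = Fintype.card ι := by
  unfold hammingNorm
  rw [add_comm]
  exact Finset.card_filter_add_card_filter_not (s := univ) (fun l => c l = 0)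

lemma norm_split {F : Type} [Field F] [DecidableEq F] {ι : Type} [Fintype ι] [DecidableEq ι] (t : ι)
    (c : ι → F) :
    hammingNorm c = (if c t = 0 then 0 else 1) + hammingNorm (restrictTo {t} c) := by
  unfold hammingNorm
  rw [Finset.card_filter, Finset.card_filter,
    ← Finset.add_sum_erase univ _ (Finset.mem_univ t)]
  congr 1
  · simp
  · exact Finset.sum_subtype _ (by simp) _

lemma card_transfer {α β : Type} {_ : Fintype α} (f : α → β) (P : α → Prop) {_ : DecidablePred P} (Q : β → Prop)
    (h1 : ∀ a, P a → Q (f a)) (hinj : ∀ a b, P a → P b → f a = f b → a = b)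
    (h2 : ∀ b, Q b → ∃ a, P a ∧ f a = b) :
    Nat.card {b // Q b} = #{a | P a} := by
  rw [← Fintype.card_subtype, ← Nat.card_eq_fintype_card]
  symm
  apply Nat.card_eq_of_bijective (fun a : {a // P a} => (⟨f a.1, h1 a.1 a.2⟩ : {b // Q b}))
  constructor
  · rintro ⟨a, ha⟩ ⟨b, hb⟩ h
    simp at h
    exact Subtype.ext (hinj a b ha hb h)
  · rintro ⟨b, hb⟩
    obtain ⟨a, ha, rfl⟩ := h2 b hb
    exact ⟨⟨a, ha⟩, rfl⟩

end Helpers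

/-- 2-design properties of the weight-`(q²-q)` codewords of the shortened ovoid code
`C_{{t₁}}` and of the code `D = ((C^⊥)_{{t₁}})^⊥`: through any two coordinate positions
there pass exactly `(q-1)(q²-q-1)` supports of weight-`(q²-q)` codewords, and for `D`
exactly `q-1` weight-`(q²-q)` codewords avoid any two given positions (so the complements
of these supports form, with multiplicity `q-1`, a Steiner system `2-(q², q, 1)`, i.e.
an affine plane of order `q`). -/
theorem statement19 {F : Type} [Field F] [Fintype F] [DecidableEq F]
    (hq4 : 4 ≤ Fintype.card F)
    (C : Submodule F (Fin (Fintype.card F ^ 2 + 1) → F))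
    (hdim : Module.finrank F ↥C = 4)
    (hmd : IsMinDist C (Fintype.card F ^ 2 - Fintype.card F))
    (t1 : Fin (Fintype.card F ^ 2 + 1)) :
    -- (1) in the shortened code `C_{{t₁}}`:
    (∀ i j : {x : Fin (Fintype.card F ^ 2 + 1) // x ∉ ({t1} : Finset _)}, i ≠ j →
      Nat.card {c : {x : Fin (Fintype.card F ^ 2 + 1) // x ∉ ({t1} : Finset _)} → F //
          c ∈ shortenedCode C {t1} ∧
          hammingNorm c = Fintype.card F ^ 2 - Fintype.card F ∧ c i ≠ 0 ∧ c j ≠ 0}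
        = (Fintype.card F - 1) * (Fintype.card F ^ 2 - Fintype.card F - 1)) ∧
    -- (2) in the code `D = ((C^⊥)_{{t₁}})^⊥`:
    (∀ i j : {x : Fin (Fintype.card F ^ 2 + 1) // x ∉ ({t1} : Finset _)}, i ≠ j →
      Nat.card {c : {x : Fin (Fintype.card F ^ 2 + 1) // x ∉ ({t1} : Finset _)} → F //
          c ∈ dualCode (shortenedCode (dualCode C) {t1}) ∧
          hammingNorm c = Fintype.card F ^ 2 - Fintype.card F ∧ c i ≠ 0 ∧ c j ≠ 0}
        = (Fintype.card F - 1) * (Fintype.card F ^ 2 - Fintype.card F - 1) ∧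
      Nat.card {c : {x : Fin (Fintype.card F ^ 2 + 1) // x ∉ ({t1} : Finset _)} → F //
          c ∈ dualCode (shortenedCode (dualCode C) {t1}) ∧
          hammingNorm c = Fintype.card F ^ 2 - Fintype.card F ∧ c i = 0 ∧ c j = 0}
        = Fintype.card F - 1) := by
  classical
  have hcard : Fintype.card (Fin (Fintype.card F ^ 2 + 1)) = Fintype.card F ^ 2 + 1 := by simp
  have hqq : Fintype.card F + Fintype.card F ≤ Fintype.card F ^ 2 := by nlinarith
  have hZ : ∀ c ∈ C, c ≠ 0 → #{l | c l = 0} ≤ Fintype.card F + 1 := by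
    intro c hc hc0
    have h1 := hmd.2 c hc hc0
    have h2 := norm_add_zeros c
    rw [hcard] at h2
    omega
  have hZ2 : ∀ c ∈ C, c ≠ 0 → 2 ≤ #{l | c l = 0} → #{l | c l = 0} = Fintype.card F + 1 := by
    intro c hc hc0 h
    obtain ⟨a, ha, b, hb, hab⟩ := Finset.one_lt_card.1 h
    simp at ha hb
    exact core_Z hcard C hdim hZ c hc hc0 a b hab ha hb
  -- key facts relating weights
  have hw : ∀ c ∈ C, c ≠ 0 → (hammingNorm (restrictTo {t1} c) = Fintype.card F ^ 2 - Fintype.card F ↔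
      c t1 = 0 ∧ #{l | c l = 0} = Fintype.card F + 1) := by
    intro c hc hc0
    have h1 := norm_add_zeros c
    have h2 := norm_split t1 c
    have h3 := hZ2 c hc hc0
    rw [hcard] at h1
    split_ifs at h2 with h
    · simp only [h, true_and]
      omega
    · simp only [h, false_and, iff_false]
      intro h4
      omega
  have hne : ∀ c : Fin (Fintype.card F ^ 2 + 1) → F, hammingNorm (restrictTo {t1} c) = Fintype.card F ^ 2 - Fintype.card F → c ≠ 0 := by
    rintro c h rfl
    rw [map_zero, hammingNorm_zero] at h
    omega
  have hinj : ∀ a b, a ∈ C → b ∈ C → restrictTo {t1} a = restrictTo {t1} b → a = b := by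
    intro a b ha hb hab
    by_contra hcon
    have hs : a - b ≠ 0 := sub_ne_zero.2 hcon
    have h1 := hmd.2 _ (C.sub_mem ha hb) hs
    have h2 := norm_split t1 (a - b)
    rw [map_sub, hab, sub_self, hammingNorm_zero] at h2
    split_ifs at h2 <;> omega
  have hne' : ∀ i : {x : Fin (Fintype.card F ^ 2 + 1) // x ∉ ({t1} : Finset _)}, t1 ≠ i := by
    rintro ⟨i, hi⟩ rfl
    simp at hi
  have key := fun (i j : {x : Fin (Fintype.card F ^ 2 + 1) // x ∉ ({t1} : Finset _)}) (hij : i ≠ j) =>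
    core_count hcard C hdim hZ t1 i j (hne' i) (hne' j) (fun h => hij (Subtype.ext h))
  refine ⟨?_, ?_⟩
  · intro i j hij
    rw [← (key i j hij).1]
    apply card_transfer (restrictTo {t1})
    · rintro c ⟨hc, hc0, ht, hz, hi, hj⟩
      exact ⟨⟨c, ⟨hc, by simpa [mem_zeroOn'] using ht⟩, rfl⟩, (hw c hc hc0).2 ⟨ht, hz⟩, hi, hj⟩
    · intro a b ha hb; exact hinj a b ha.1 hb.1
    · rintro _ ⟨⟨c, ⟨hc, ht⟩, rfl⟩, hn, hi, hj⟩
      have hc0 := hne c hn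
      have := (hw c hc hc0).1 hn
      exact ⟨c, ⟨hc, hc0, this.1, this.2, hi, hj⟩, rfl⟩
  · intro i j hij
    rw [D_eq, ← (key i j hij).1]
    constructor
    · apply card_transfer (restrictTo {t1})
      · rintro c ⟨hc, hc0, ht, hz, hi, hj⟩
        exact ⟨⟨c, hc, rfl⟩, (hw c hc hc0).2 ⟨ht, hz⟩, hi, hj⟩
      · intro a b ha hb; exact hinj a b ha.1 hb.1
      · rintro _ ⟨⟨c, hc, rfl⟩, hn, hi, hj⟩
        have hc0 := hne c hn
        have := (hw c hc hc0).1 hn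
        exact ⟨c, ⟨hc, hc0, this.1, this.2, hi, hj⟩, rfl⟩
    · refine Eq.trans ?_ (key i j hij).2
      apply card_transfer (restrictTo {t1})
      · rintro c ⟨hc, hc0, ht, hz, hi, hj⟩
        exact ⟨⟨c, hc, rfl⟩, (hw c hc hc0).2 ⟨ht, hz⟩, hi, hj⟩
      · intro a b ha hb; exact hinj a b ha.1 hb.1
      · rintro _ ⟨⟨c, hc, rfl⟩, hn, hi, hj⟩
        have hc0 := hne c hn
        have := (hw c hc hc0).1 hn
        exact ⟨c, ⟨hc, hc0, this.1, this.2, hi, hj⟩, rfl⟩
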